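/- Let p, q ≥ 2 be coprime integers, and let A ∈ ℤ[X] be the polynomial satisfying A(X)·(X^p − 1)·(X^q − 1) = (X^{pq} − 1)·(X − 1). Set g = (p−1)(q−1)/2 (a natural number, since p and q are not both even). Define f : ℝ → ℝ by f(t) = t^{−g} · A(t) for t > 0 (real power). Then the second derivative of f at t = 1 equals (p² − 1)(q² − 1)/12; in particular it is nonzero. -/

import Mathlib

open Polynomial in
/-- The value and the first two derivatives at `1` of `1 + X + ⋯ + X ^ (n - 1)`. -/
theorem geom_sum_derivatives_eval_one (n : ℕ) :
    (∑ i ∈ Finset.range n, (X : ℝ[X]) ^ i).eval 1 = n ∧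
    (derivative (∑ i ∈ Finset.range n, (X : ℝ[X]) ^ i)).eval 1 = n * (n - 1) / 2 ∧
    (derivative (derivative (∑ i ∈ Finset.range n, (X : ℝ[X]) ^ i))).eval 1 =
      n * (n - 1) * (n - 2) / 3 := by
  induction n with
  | zero => simp
  | succ n ih =>
    obtain ⟨h0, h1, h2⟩ := ih
    rw [geom_sum_succ]
    generalize (∑ i ∈ Finset.range n, (X : ℝ[X]) ^ i) = S at h0 h1 h2 ⊢
    simp only [derivative_add, derivative_mul, derivative_X, derivative_one, eval_add, eval_mul,
      eval_X, eval_one, one_mul, add_zero, h0, h1, h2]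
    push_cast
    refine ⟨rfl, ?_, ?_⟩ <;> ring

open Polynomial in
theorem hasDerivAt_rpow_mul_polynomial_eval (B : ℝ[X]) (r : ℝ) {t : ℝ} (ht : 0 < t) :
    HasDerivAt (fun s : ℝ => s ^ r * B.eval s)
      (r * (t ^ (r - 1) * B.eval t) + t ^ r * (derivative B).eval t) t := by
  simpa only [mul_assoc] using
    (Real.hasDerivAt_rpow_const (p := r) (Or.inl ht.ne')).fun_mul (B.hasDerivAt t)

open Polynomial in
theorem deriv_deriv_rpow_mul_polynomial_eval_one (B : ℝ[X]) (r : ℝ) {f : ℝ → ℝ}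
    (hf : ∀ t : ℝ, 0 < t → f t = t ^ r * B.eval t) :
    deriv (deriv f) 1 = r * (r - 1) * B.eval 1 + 2 * r * (derivative B).eval 1 +
      (derivative (derivative B)).eval 1 := by
  have hderiv : ∀ t : ℝ, 0 < t →
      deriv f t = r * (t ^ (r - 1) * B.eval t) + t ^ r * (derivative B).eval t := by
    intro t ht
    refine ((hasDerivAt_rpow_mul_polynomial_eval B r ht).congr_of_eventuallyEq ?_).deriv
    filter_upwards [lt_mem_nhds ht] with s hs using hf s hs
  have h := ((hasDerivAt_rpow_mul_polynomial_eval B (r - 1) one_pos).const_mul r).add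
    (hasDerivAt_rpow_mul_polynomial_eval (derivative B) r one_pos)
  have heq := h.congr_of_eventuallyEq (f₁ := deriv f) (by
    filter_upwards [lt_mem_nhds (one_pos (α := ℝ))] with s hs using hderiv s hs)
  rw [heq.deriv]
  simp only [Real.one_rpow]
  ring

open Polynomial in
/-- The Alexander polynomial of a torus knot as a quotient of geometric sums. -/
theorem alexander_mul_geom_sum {R : Type*} [CommRing R] [IsDomain R] {p q : ℕ} {A : R[X]}
    (hA : A * ((X ^ p - 1) * (X ^ q - 1)) = (X ^ (p * q) - 1) * (X - 1)) :
    A * ((∑ i ∈ Finset.range p, X ^ i) * ∑ i ∈ Finset.range q, X ^ i) =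
      ∑ i ∈ Finset.range (p * q), X ^ i := by
  have hX : (X - 1 : R[X]) ≠ 0 := X_sub_C_ne_zero 1
  apply mul_right_cancel₀ (pow_ne_zero 2 hX)
  simp only [← geom_sum_mul] at hA
  linear_combination hA

theorem torus_knot_normalized_alexander_second_deriv_at_one
    (p q : ℕ) (hp : 2 ≤ p) (hq : 2 ≤ q) (hpq : Nat.Coprime p q)
    (A : Polynomial ℤ)
    (hA : A * ((Polynomial.X ^ p - 1) * (Polynomial.X ^ q - 1)) =
      (Polynomial.X ^ (p * q) - 1) * (Polynomial.X - 1))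
    (g : ℕ) (hg : 2 * g = (p - 1) * (q - 1))
    (f : ℝ → ℝ)
    (hf : ∀ t : ℝ, 0 < t → f t = t ^ (-(g : ℝ)) * (Polynomial.aeval t A)) :
    deriv (deriv f) 1 = ((p : ℝ) ^ 2 - 1) * ((q : ℝ) ^ 2 - 1) / 12 ∧
      deriv (deriv f) 1 ≠ 0 := by
  have hp' : (2 : ℝ) ≤ p := by exact_mod_cast hp
  have hq' : (2 : ℝ) ≤ q := by exact_mod_cast hq
  have hgR : (g : ℝ) = (p - 1) * (q - 1) / 2 := by
    have h : (2 : ℝ) * g = ((p - 1 : ℕ) : ℝ) * ((q - 1 : ℕ) : ℝ) := by exact_mod_cast hg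
    rw [Nat.cast_sub (by lia), Nat.cast_sub (by lia), Nat.cast_one] at h
    linarith
  have key : deriv (deriv f) 1 = ((p : ℝ) ^ 2 - 1) * ((q : ℝ) ^ 2 - 1) / 12 := by
    rw [deriv_deriv_rpow_mul_polynomial_eval_one (A.map (algebraMap ℤ ℝ)) (-(g : ℝ))
      (by simpa only [Polynomial.eval_map_algebraMap] using hf)]
    have hB := alexander_mul_geom_sum (A := A.map (algebraMap ℤ ℝ)) (p := p) (q := q)
      (by simpa using congrArg (Polynomial.map (algebraMap ℤ ℝ)) hA)
    generalize A.map (algebraMap ℤ ℝ) = B at hB ⊢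
    obtain ⟨a0, a1, a2⟩ := geom_sum_derivatives_eval_one p
    obtain ⟨b0, b1, b2⟩ := geom_sum_derivatives_eval_one q
    obtain ⟨c0, c1, c2⟩ := geom_sum_derivatives_eval_one (p * q)
    rw [← hB] at c0 c1 c2
    simp only [Polynomial.derivative_mul, Polynomial.derivative_add, Polynomial.eval_add,
      Polynomial.eval_mul, a0, a1, a2, b0, b1, b2, Nat.cast_mul] at c0 c1 c2
    have hpq0 : (p : ℝ) * q ≠ 0 := by positivity
    have e0 : B.eval 1 = 1 := by
      apply mul_right_cancel₀ hpq0
      linear_combination c0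
    rw [e0] at c1 c2 ⊢
    have e1 : B.derivative.eval 1 = (p - 1) * (q - 1) / 2 := by
      apply mul_right_cancel₀ hpq0
      linear_combination c1
    rw [e1] at c2 ⊢
    rw [hgR]
    apply mul_right_cancel₀ hpq0
    linear_combination c2
  refine ⟨key, ?_⟩
  rw [key]
  have hp1 : 0 < (p : ℝ) ^ 2 - 1 := by nlinarith
  have hq1 : 0 < (q : ℝ) ^ 2 - 1 := by nlinarith
  positivity
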